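/- For every positive integer n, 2·spt(n) + N_2(n) = 2n·p(n), where spt(n) = ∑_{π ∈ P(n)} (multiplicity of s(π) in π), N_2(n) = ∑_{π ∈ P(n)} (l(π) − #(π))^2, and p(n) = |P(n)|. Equivalently, spt(n) = n·p(n) − (1/2)·N_2(n). -/

import Mathlib

open Finset

/-- The smallest part of a partition. -/
noncomputable def sPart {n : ℕ} (π : n.Partition) : ℕ := sInf {i | i ∈ π.parts}

/-- The largest part of a partition. -/
def lPart {n : ℕ} (π : n.Partition) : ℕ := π.parts.sup

/-! ### Truncated `q`-series in a commutative ring with a nilpotent element `q` -/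

section QSeries

variable {R : Type*} [CommRing R]

/-- The Gaussian binomial coefficient `[n, k]_q`. -/
def gaussBinom (q : R) : ℕ → ℕ → R
  | _, 0 => 1
  | 0, _ + 1 => 0
  | n + 1, k + 1 => gaussBinom q n k + q ^ (k + 1) * gaussBinom q n (k + 1)

/-- The `q`-Pochhammer symbol `(q; q)_n`. -/
def qPoch (q : R) (n : ℕ) : R := ∏ i ∈ range n, (1 - q ^ (i + 1))

/-- The geometric sum `∑_{j < M} q ^ (k j)`, the inverse of `1 - q ^ k` when `q ^ M = 0`. -/
def geomInv (M : ℕ) (q : R) (k : ℕ) : R := ∑ j ∈ range M, (q ^ k) ^ j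

/-- The inverse of `(q; q)_n` when `q ^ M = 0`. -/
def qPochInv (M : ℕ) (q : R) (n : ℕ) : R := ∏ i ∈ range n, geomInv M q (i + 1)

/-- The value of `q ^ k / (1 - q ^ k) ^ 2` when `q ^ M = 0`. -/
def geomVar (M : ℕ) (q : R) (k : ℕ) : R := q ^ k * geomInv M q k ^ 2

/-- The sum of `q ^ k / (1 - q ^ k) ^ 2` over `1 ≤ k ≤ n` when `q ^ M = 0`. -/
def geomVarSum (M : ℕ) (q : R) (n : ℕ) : R := ∑ k ∈ range n, geomVar M q (k + 1)

/-- The normalized summand `q ^ (n ^ 2) [N, n] (q; q)_N / (q; q)_n` of the `q`-Vandermonde sum. -/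
def durfeeTerm (M : ℕ) (q : R) (N n : ℕ) : R :=
  q ^ (n ^ 2) * gaussBinom q N n * qPoch q N * qPochInv M q n

/-- The truncated moment `∑_{i < M} i ^ r q ^ i [i, m]`. -/
def gaussMoment (M : ℕ) (q : R) (r m : ℕ) : R :=
  ∑ i ∈ range M, (i : R) ^ r * (q ^ i * gaussBinom q i m)

variable {q : R} {M : ℕ}

@[simp] lemma gaussBinom_zero_right (q : R) (n : ℕ) : gaussBinom q n 0 = 1 := by
  cases n <;> rfl

@[simp] lemma gaussBinom_zero_succ (q : R) (k : ℕ) : gaussBinom q 0 (k + 1) = 0 := rfl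

lemma gaussBinom_succ_succ (q : R) (n k : ℕ) : gaussBinom q (n + 1) (k + 1) =
    gaussBinom q n k + q ^ (k + 1) * gaussBinom q n (k + 1) := rfl

lemma gaussBinom_eq_zero (q : R) {n k : ℕ} (h : n < k) : gaussBinom q n k = 0 := by
  induction n generalizing k with
  | zero => obtain ⟨k, rfl⟩ := Nat.exists_eq_add_of_lt h; simp
  | succ n ih =>
    obtain ⟨k, rfl⟩ : ∃ j, k = j + 1 := ⟨k - 1, by omega⟩
    rw [gaussBinom_succ_succ, ih (by omega), ih (by omega)]; simp

@[simp] lemma gaussBinom_self (q : R) (n : ℕ) : gaussBinom q n n = 1 := by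
  induction n with
  | zero => simp
  | succ n ih => rw [gaussBinom_succ_succ, ih, gaussBinom_eq_zero q (by omega)]; simp

lemma gaussBinom_succ_right (q : R) (N n : ℕ) :
    q ^ n * (1 - q ^ (n + 1)) * gaussBinom q N (n + 1) =
      (q ^ n - q ^ N) * gaussBinom q N n := by
  induction N generalizing n with
  | zero => cases n <;> simp
  | succ N ih =>
    cases n with
    | zero =>
      have h := ih 0
      simp only [gaussBinom_succ_succ, gaussBinom_zero_right] at h ⊢
      linear_combination q * h
    | succ n =>
      have h₁ := ih n
      have h₂ := ih (n + 1)
      simp only [gaussBinom_succ_succ] at h₁ h₂ ⊢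
      linear_combination q ^ (n + 2) * h₂ + q * h₁

lemma gaussBinom_absorb (q : R) (N n : ℕ) :
    (1 - q ^ (n + 1)) * gaussBinom q (N + 1) (n + 1) =
      (1 - q ^ (N + 1)) * gaussBinom q N n := by
  rw [gaussBinom_succ_succ]
  linear_combination q * gaussBinom_succ_right q N n

/-- A form of the `q`-Vandermonde identity. -/
lemma sum_gaussBinom_mul_gaussBinom (q : R) (a b c : ℕ) :
    ∑ m ∈ range (b + 1), q ^ (m * (m + c)) * gaussBinom q a (m + c) * gaussBinom q b m =
      gaussBinom q (a + b) (b + c) := by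
  induction b generalizing a c with
  | zero => simp
  | succ b ih =>
    have key := ih (a + 1) (c + 1)
    rw [show a + (b + 1) = a + 1 + b by ring, show b + 1 + c = b + (c + 1) by ring, ← key,
      sum_range_succ']
    have h : ∑ m ∈ range (b + 1), q ^ (m * (m + (c + 1))) * gaussBinom q a (m + c) *
        gaussBinom q b m = ∑ m ∈ range (b + 1), q ^ ((m + 1) * (m + 1 + (c + 1))) *
          gaussBinom q a (m + 1 + c) * gaussBinom q b (m + 1) + gaussBinom q a c := by
      have := sum_range_succ' (fun m => q ^ (m * (m + (c + 1))) * gaussBinom q a (m + c) *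
        gaussBinom q b m) (b + 1)
      rw [sum_range_succ, gaussBinom_eq_zero q (Nat.lt_succ_self b)] at this
      simpa using this
    have h' : ∀ m, q ^ (m * (m + (c + 1))) * gaussBinom q (a + 1) (m + (c + 1)) *
        gaussBinom q b m = q ^ (m * (m + (c + 1))) * gaussBinom q a (m + c) * gaussBinom q b m +
          q ^ ((m + 1) * (m + 1 + c)) * gaussBinom q a (m + 1 + c) * gaussBinom q b m := by
      intro m
      rw [← add_assoc m c 1, gaussBinom_succ_succ, show m + 1 + c = m + c + 1 by ring]
      ring
    simp only [h', sum_add_distrib]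
    rw [h, gaussBinom_zero_right, add_right_comm, ← sum_add_distrib]
    simp only [zero_mul, pow_zero, one_mul, zero_add, mul_one, add_left_inj]
    refine sum_congr rfl fun m _ => ?_
    rw [gaussBinom_succ_succ]
    ring

lemma one_sub_pow_mul_geomInv (hq : q ^ M = 0) {k : ℕ} (hk : 0 < k) :
    (1 - q ^ k) * geomInv M q k = 1 := by
  rw [geomInv, mul_neg_geom_sum, ← pow_mul, mul_comm, pow_mul, hq, zero_pow hk.ne', sub_zero]

lemma qPoch_succ (q : R) (n : ℕ) : qPoch q (n + 1) = qPoch q n * (1 - q ^ (n + 1)) :=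
  prod_range_succ _ _

lemma qPochInv_succ (M : ℕ) (q : R) (n : ℕ) :
    qPochInv M q (n + 1) = qPochInv M q n * geomInv M q (n + 1) :=
  prod_range_succ _ _

lemma geomVarSum_succ (M : ℕ) (q : R) (n : ℕ) :
    geomVarSum M q (n + 1) = geomVarSum M q n + geomVar M q (n + 1) :=
  sum_range_succ _ _

lemma qPoch_mul_qPochInv (hq : q ^ M = 0) (n : ℕ) : qPoch q n * qPochInv M q n = 1 := by
  rw [qPoch, qPochInv, ← prod_mul_distrib]
  exact prod_eq_one fun i _ => one_sub_pow_mul_geomInv hq i.succ_pos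

lemma durfeeTerm_zero (N : ℕ) : durfeeTerm M q N 0 = qPoch q N := by
  simp [durfeeTerm, qPochInv]

lemma durfeeTerm_eq_zero {N n : ℕ} (h : N < n) : durfeeTerm M q N n = 0 := by
  simp [durfeeTerm, gaussBinom_eq_zero q h]

lemma durfeeTerm_succ_succ (hq : q ^ M = 0) (N n : ℕ) :
    durfeeTerm M q (N + 1) (n + 1) = durfeeTerm M q N (n + 1) -
      q ^ (N + (n + 1) + 1) * durfeeTerm M q N (n + 1) + q ^ (N + n + 1) * durfeeTerm M q N n := by
  have hu := one_sub_pow_mul_geomInv hq (Nat.add_one_pos n)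
  have h := gaussBinom_succ_right q N n
  simp only [durfeeTerm, gaussBinom_succ_succ, qPoch_succ, qPochInv_succ] at *
  linear_combination -q ^ (n ^ 2 + n + 1) * qPoch q N * qPochInv M q n * geomInv M q (n + 1) * h +
    q ^ (N + n + 1 + n ^ 2) * gaussBinom q N n * qPoch q N * qPochInv M q n * hu

lemma durfeeTerm_mul_geomVar (hq : q ^ M = 0) (N n : ℕ) :
    q ^ (N + n + 1) * durfeeTerm M q N n * geomVar M q (n + 1) =
      geomVar M q (N + 1) * durfeeTerm M q (N + 1) (n + 1) := by
  have hu := one_sub_pow_mul_geomInv hq (Nat.add_one_pos n)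
  have hU := one_sub_pow_mul_geomInv hq (Nat.add_one_pos N)
  have h := gaussBinom_absorb q N n
  have h' : gaussBinom q N n * geomInv M q (n + 1) =
      geomInv M q (N + 1) * gaussBinom q (N + 1) (n + 1) := by
    linear_combination -geomInv M q (n + 1) * geomInv M q (N + 1) * h -
      gaussBinom q N n * geomInv M q (n + 1) * hU +
      geomInv M q (N + 1) * gaussBinom q (N + 1) (n + 1) * hu
  simp only [durfeeTerm, geomVar, qPoch_succ, qPochInv_succ] at *
  linear_combination q ^ (N + 1 + (n + 1) ^ 2) * qPoch q N * qPochInv M q n *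
    geomInv M q (n + 1) * (h' - geomInv M q (N + 1) * gaussBinom q (N + 1) (n + 1) * hU)

lemma sum_durfeeTerm_mul (hq : q ^ M = 0) (N : ℕ) (f : ℕ → R) :
    ∑ n ∈ range (N + 2), durfeeTerm M q (N + 1) n * f n =
      ∑ n ∈ range (N + 1), durfeeTerm M q N n * f n +
        ∑ n ∈ range (N + 1), q ^ (N + n + 1) * durfeeTerm M q N n * (f (n + 1) - f n) := by
  have h₁ : ∀ g : ℕ → R, ∑ n ∈ range (N + 1), durfeeTerm M q N n * g n =
      ∑ n ∈ range (N + 1), durfeeTerm M q N (n + 1) * g (n + 1) + durfeeTerm M q N 0 * g 0 := by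
    intro g
    have := sum_range_succ' (fun n => durfeeTerm M q N n * g n) (N + 1)
    rwa [sum_range_succ, durfeeTerm_eq_zero (Nat.lt_succ_self N), zero_mul, add_zero] at this
  have h₂ := h₁ fun n => q ^ (N + n + 1) * f n
  have h₃ : ∑ n ∈ range (N + 1), q ^ (N + n + 1) * durfeeTerm M q N n * (f (n + 1) - f n) =
      ∑ n ∈ range (N + 1), q ^ (N + n + 1) * durfeeTerm M q N n * f (n + 1) -
        ∑ n ∈ range (N + 1), durfeeTerm M q N n * (q ^ (N + n + 1) * f n) := by
    rw [← sum_sub_distrib]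
    exact sum_congr rfl fun n _ => by ring
  rw [h₃, h₂, h₁ f, sum_range_succ']
  have h₄ : ∑ n ∈ range (N + 1), durfeeTerm M q (N + 1) (n + 1) * f (n + 1) =
      ∑ n ∈ range (N + 1), durfeeTerm M q N (n + 1) * f (n + 1) -
      ∑ n ∈ range (N + 1), durfeeTerm M q N (n + 1) * (q ^ (N + (n + 1) + 1) * f (n + 1)) +
      ∑ n ∈ range (N + 1), q ^ (N + n + 1) * durfeeTerm M q N n * f (n + 1) := by
    rw [← sum_sub_distrib, ← sum_add_distrib]
    refine sum_congr rfl fun n _ => ?_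
    rw [durfeeTerm_succ_succ hq]
    ring
  rw [h₄]
  simp only [durfeeTerm_zero, qPoch_succ]
  ring

lemma sum_durfeeTerm (hq : q ^ M = 0) (N : ℕ) :
    ∑ n ∈ range (N + 1), durfeeTerm M q N n = 1 := by
  induction N with
  | zero => simp [durfeeTerm_zero, qPoch]
  | succ N ih => simpa [ih] using sum_durfeeTerm_mul hq N fun _ => 1

/-- The finite form of the generating function identity behind Andrews' theorem. -/
lemma geomVarSum_eq (hq : q ^ M = 0) (N : ℕ) :
    geomVarSum M q N = ∑ k ∈ range N, geomVar M q (k + 1) * qPoch q (k + 1) +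
      ∑ n ∈ range (N + 1), durfeeTerm M q N n * geomVarSum M q n := by
  induction N with
  | zero => simp [geomVarSum]
  | succ N ih =>
    have h₁ := sum_durfeeTerm hq (N + 1)
    rw [sum_range_succ', durfeeTerm_zero] at h₁
    have h₂ : ∑ n ∈ range (N + 1), q ^ (N + n + 1) * durfeeTerm M q N n *
        (geomVarSum M q (n + 1) - geomVarSum M q n) =
        geomVar M q (N + 1) * ∑ n ∈ range (N + 1), durfeeTerm M q (N + 1) (n + 1) := by
      rw [mul_sum]
      refine sum_congr rfl fun n _ => ?_
      rw [geomVarSum_succ, add_sub_cancel_left, durfeeTerm_mul_geomVar hq]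
    rw [sum_durfeeTerm_mul hq, h₂, geomVarSum_succ, sum_range_succ]
    linear_combination ih - geomVar M q (N + 1) * h₁

lemma pow_mul_qPoch {K N : ℕ} (hq : q ^ M = 0) {c : ℕ} (hK : K ≤ N) (h : M ≤ c + K + 1) :
    q ^ c * qPoch q N = q ^ c * qPoch q K := by
  induction N, hK using Nat.le_induction with
  | base => rfl
  | succ N hN ih =>
    have h0 : q ^ (c + (N + 1)) = 0 := pow_eq_zero_of_le (by omega) hq
    rw [qPoch_succ]
    rw [pow_add] at h0
    linear_combination ih - qPoch q N * h0

lemma qPoch_mul_gaussBinom (q : R) (n k : ℕ) :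
    qPoch q n * qPoch q k * gaussBinom q (n + k) k = qPoch q (n + k) := by
  induction k with
  | zero => simp [qPoch]
  | succ k ih =>
    have h := gaussBinom_absorb q (n + k) k
    rw [← add_assoc, qPoch_succ, qPoch_succ, ← ih]
    linear_combination qPoch q n * qPoch q k * h

lemma durfeeTerm_eq_of_pow_succ {N n : ℕ} (hq : q ^ (N + 1) = 0) (hn : n ≤ N) :
    durfeeTerm (N + 1) q N n = q ^ (n ^ 2) * qPochInv (N + 1) q n ^ 2 * qPoch q N := by
  obtain ⟨d, rfl⟩ := Nat.exists_eq_add_of_le' hn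
  have h₁ := qPoch_mul_gaussBinom q d n
  have h₂ : q ^ (n ^ 2) * qPoch q (d + n) = q ^ (n ^ 2) * qPoch q d :=
    pow_mul_qPoch hq (by omega) (by nlinarith [Nat.le_self_pow two_ne_zero n])
  have h₃ := qPoch_mul_qPochInv hq n
  rw [durfeeTerm]
  linear_combination gaussBinom q (d + n) n * qPochInv (d + n + 1) q n * h₂ +
    q ^ (n ^ 2) * qPochInv (d + n + 1) q n ^ 2 * h₁ -
    q ^ (n ^ 2) * qPochInv (d + n + 1) q n * qPoch q d * gaussBinom q (d + n) n * h₃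

lemma sum_mul_gaussBinom_succ (hq : q ^ M = 0) (f : ℕ → R) (m : ℕ) :
    ∑ i ∈ range M, f i * (q ^ i * gaussBinom q i (m + 1)) =
      q * ∑ i ∈ range M, f (i + 1) * (q ^ i * gaussBinom q i m) +
        q ^ (m + 2) * ∑ i ∈ range M, f (i + 1) * (q ^ i * gaussBinom q i (m + 1)) := by
  have h := sum_range_succ' (fun i => f i * (q ^ i * gaussBinom q i (m + 1))) M
  rw [sum_range_succ, hq, gaussBinom_zero_succ] at h
  simp only [zero_mul, mul_zero, add_zero] at h
  rw [h, mul_sum, mul_sum, ← sum_add_distrib]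
  refine sum_congr rfl fun i _ => ?_
  rw [gaussBinom_succ_succ]
  ring

lemma sum_mul_gaussBinom_zero (hq : q ^ M = 0) (f : ℕ → R) :
    ∑ i ∈ range M, f i * (q ^ i * gaussBinom q i 0) =
      q * ∑ i ∈ range M, f (i + 1) * (q ^ i * gaussBinom q i 0) + f 0 := by
  have h := sum_range_succ' (fun i => f i * (q ^ i * gaussBinom q i 0)) M
  rw [sum_range_succ, hq] at h
  simp only [mul_zero, add_zero, pow_zero, gaussBinom_zero_right, mul_one] at h
  simp only [gaussBinom_zero_right, mul_one]
  rw [h, mul_sum]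
  congr 1
  exact sum_congr rfl fun i _ => by ring

lemma sum_succ_mul (g : ℕ → R) : ∑ i ∈ range M, ((i + 1 : ℕ) : R) ^ 1 * g i =
    ∑ i ∈ range M, (i : R) ^ 1 * g i + ∑ i ∈ range M, (i : R) ^ 0 * g i := by
  rw [← sum_add_distrib]
  exact sum_congr rfl fun i _ => by push_cast; ring

lemma sum_succ_sq_mul (g : ℕ → R) : ∑ i ∈ range M, ((i + 1 : ℕ) : R) ^ 2 * g i =
    ∑ i ∈ range M, (i : R) ^ 2 * g i + 2 * ∑ i ∈ range M, (i : R) ^ 1 * g i +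
      ∑ i ∈ range M, (i : R) ^ 0 * g i := by
  rw [mul_sum, ← sum_add_distrib, ← sum_add_distrib]
  exact sum_congr rfl fun i _ => by push_cast; ring

lemma gaussMoment_zero (hq : q ^ M = 0) (m : ℕ) :
    gaussMoment M q 0 m = q ^ m * qPochInv M q (m + 1) := by
  induction m with
  | zero =>
    have h := sum_mul_gaussBinom_zero hq fun i => (i : R) ^ 0
    have hu := one_sub_pow_mul_geomInv hq one_pos
    simp only [gaussMoment, qPochInv, pow_zero] at h ⊢
    simp only [zero_add, range_one, prod_singleton]
    linear_combination geomInv M q 1 * h - (∑ i ∈ range M, 1 * (q ^ i * gaussBinom q i 0)) * hu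
  | succ m ih =>
    have h := sum_mul_gaussBinom_succ hq (fun i => (i : R) ^ 0) m
    have hu := one_sub_pow_mul_geomInv hq (Nat.add_one_pos (m + 1))
    rw [qPochInv_succ]
    simp only [gaussMoment, pow_zero] at h ih hu ⊢
    linear_combination geomInv M q (m + 2) * h -
      (∑ i ∈ range M, 1 * (q ^ i * gaussBinom q i (m + 1))) * hu + q * geomInv M q (m + 2) * ih

lemma variance_step {y w A c₀ c₁ c₂ x₀ x₁ x₂ : R} (hw : (1 - y) * w = 1)
    (h₀ : x₀ = c₀ + y * x₀) (h₁ : x₁ = c₁ + y * (x₁ + x₀)) (h₂ : x₂ = c₂ + y * (x₂ + 2 * x₁ + x₀))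
    (hc : c₂ * c₀ - c₁ ^ 2 = c₀ ^ 2 * A) :
    x₂ * x₀ - x₁ ^ 2 = x₀ ^ 2 * (A + y * w ^ 2) := by
  have e₀ : x₀ = w * c₀ := by linear_combination w * h₀ - x₀ * hw
  have e₁ : x₁ = w * c₁ + (w - 1) * x₀ := by linear_combination w * h₁ - (x₁ + x₀) * hw
  have e₂ : x₂ = w * c₂ + (w - 1) * (2 * x₁ + x₀) := by
    linear_combination w * h₂ - (x₂ + 2 * x₁ + x₀) * hw
  have e₃ : y * w ^ 2 = w * (w - 1) := by linear_combination -w * hw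
  rw [e₃, e₂, e₁, e₀]
  linear_combination w ^ 2 * hc

lemma gaussMoment_variance (hq : q ^ M = 0) (m : ℕ) :
    gaussMoment M q 2 m * gaussMoment M q 0 m - gaussMoment M q 1 m ^ 2 =
      gaussMoment M q 0 m ^ 2 * geomVarSum M q (m + 1) := by
  induction m with
  | zero =>
    have h₀ := sum_mul_gaussBinom_zero hq fun i => (i : R) ^ 0
    have h₁ := sum_mul_gaussBinom_zero hq fun i => (i : R) ^ 1
    have h₂ := sum_mul_gaussBinom_zero hq fun i => (i : R) ^ 2
    have hu := one_sub_pow_mul_geomInv hq one_pos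
    rw [sum_succ_mul] at h₁
    rw [sum_succ_sq_mul] at h₂
    rw [geomVarSum_succ, geomVar]
    refine variance_step (c₀ := 1) (c₁ := 0) (c₂ := 0) hu ?_ ?_ ?_ (by simp [geomVarSum])
    · simp only [gaussMoment, pow_zero] at h₀ ⊢; linear_combination h₀
    · simp only [gaussMoment, Nat.cast_zero] at h₁ ⊢; linear_combination h₁
    · simp only [gaussMoment, Nat.cast_zero] at h₂ ⊢; linear_combination h₂
  | succ m ih =>
    have h₀ := sum_mul_gaussBinom_succ hq (fun i => (i : R) ^ 0) m
    have h₁ := sum_mul_gaussBinom_succ hq (fun i => (i : R) ^ 1) m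
    have h₂ := sum_mul_gaussBinom_succ hq (fun i => (i : R) ^ 2) m
    have hu := one_sub_pow_mul_geomInv hq (Nat.add_one_pos (m + 1))
    rw [sum_succ_mul, sum_succ_mul] at h₁
    rw [sum_succ_sq_mul, sum_succ_sq_mul] at h₂
    rw [geomVarSum_succ, geomVar]
    refine variance_step (c₀ := q * gaussMoment M q 0 m)
      (c₁ := q * (gaussMoment M q 1 m + gaussMoment M q 0 m))
      (c₂ := q * (gaussMoment M q 2 m + 2 * gaussMoment M q 1 m + gaussMoment M q 0 m))
      hu ?_ ?_ ?_ (by linear_combination q ^ 2 * ih)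
    · simp only [gaussMoment, pow_zero] at h₀ ⊢; linear_combination h₀
    · simp only [gaussMoment] at h₁ ⊢; linear_combination h₁
    · simp only [gaussMoment] at h₂ ⊢; linear_combination h₂

end QSeries

/-! ### Truncated generating functions of partition statistics -/

section PartitionGenerating

variable {R : Type*} [CommRing R]

lemma Nat.Partition.le_of_mem {n : ℕ} (π : n.Partition) {i : ℕ} (hi : i ∈ π.parts) : i ≤ n := by
  simpa only [π.parts_sum] using Multiset.le_sum_of_mem hi

lemma Nat.Partition.card_le {n : ℕ} (π : n.Partition) : Multiset.card π.parts ≤ n := by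
  have := Multiset.card_nsmul_le_sum (s := π.parts) (a := 1) fun i hi => π.parts_pos hi
  simpa [π.parts_sum] using this

lemma Nat.Partition.mul_le_of_replicate_le {n j k : ℕ} (π : n.Partition)
    (h : Multiset.replicate j k ≤ π.parts) : j * k ≤ n := by
  obtain ⟨t, ht⟩ := Multiset.le_iff_exists_add.1 h
  have := π.parts_sum
  rw [ht, Multiset.sum_add, Multiset.sum_replicate, smul_eq_mul] at this
  omega

/-- Adding `j` copies of `k` to a partition. -/
def Nat.Partition.addReplicate {n : ℕ} (j k : ℕ) (hk : 0 < k) (π : n.Partition) :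
    (j * k + n).Partition where
  parts := π.parts + Multiset.replicate j k
  parts_pos := by
    intro i hi
    rcases Multiset.mem_add.1 hi with hi | hi
    · exact π.parts_pos hi
    · rw [Multiset.eq_of_mem_replicate hi]; exact hk
  parts_sum := by simp [π.parts_sum, add_comm]

lemma Nat.Partition.sum_replicate_le (n j : ℕ) {k : ℕ} (hk : 0 < k) (f : Multiset ℕ → R) :
    ∑ π : (j * k + n).Partition, (if Multiset.replicate j k ≤ π.parts then f π.parts else 0) =
      ∑ π : n.Partition, f (π.parts + Multiset.replicate j k) := by
  rw [← sum_filter]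
  symm
  refine sum_bij (fun π _ => π.addReplicate j k hk) ?_ ?_ ?_ fun _ _ => rfl
  · intro π _
    simp [Nat.Partition.addReplicate]
  · intro π _ ρ _ h
    have := congrArg Nat.Partition.parts h
    exact Nat.Partition.ext (add_right_cancel this)
  · intro π hπ
    obtain ⟨t, ht⟩ := Multiset.le_iff_exists_add.1 (mem_filter.1 hπ).2
    refine ⟨⟨t, fun {i} hi => π.parts_pos (ht ▸ Multiset.mem_add.2 (Or.inr hi)), ?_⟩,
      mem_univ _, Nat.Partition.ext ?_⟩
    · have := π.parts_sum
      rw [ht, Multiset.sum_add, Multiset.sum_replicate, smul_eq_mul] at this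
      omega
    · exact (add_comm _ _).trans ht.symm

/-- The generating function of the statistic `f` over partitions of integers less than `M`. -/
def partGen (M : ℕ) (q : R) (f : Multiset ℕ → R) : R :=
  ∑ m ∈ range M, ∑ π : m.Partition, f π.parts * q ^ m

variable {q : R} {M : ℕ}

lemma partGen_congr {f g : Multiset ℕ → R}
    (h : ∀ m < M, ∀ π : m.Partition, f π.parts = g π.parts) : partGen M q f = partGen M q g :=
  sum_congr rfl fun m hm => sum_congr rfl fun π _ => by rw [h m (mem_range.1 hm) π]

lemma partGen_add (f g : Multiset ℕ → R) :
    partGen M q (fun s => f s + g s) = partGen M q f + partGen M q g := by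
  simp only [partGen, add_mul, sum_add_distrib]

lemma partGen_sum {ι : Type*} (t : Finset ι) (f : ι → Multiset ℕ → R) :
    partGen M q (fun s => ∑ i ∈ t, f i s) = ∑ i ∈ t, partGen M q (f i) := by
  classical
  induction t using Finset.induction_on with
  | empty => simp [partGen]
  | insert a t ha ih => simp only [sum_insert ha, partGen_add, ih]

lemma partGen_const_mul (c : R) (f : Multiset ℕ → R) :
    partGen M q (fun s => c * f s) = c * partGen M q f := by
  simp only [partGen, mul_sum, mul_assoc]

lemma partGen_replicate_le (hq : q ^ M = 0) (j : ℕ) {k : ℕ} (hk : 0 < k) (f : Multiset ℕ → R) :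
    partGen M q (fun s => if Multiset.replicate j k ≤ s then f s else 0) =
      q ^ (j * k) * partGen M q (fun s => f (s + Multiset.replicate j k)) := by
  set F : ℕ → R := fun m =>
    ∑ π : m.Partition, (if Multiset.replicate j k ≤ π.parts then f π.parts else 0) * q ^ m
  have h₁ : ∑ m ∈ range (j * k + M), F m = ∑ m ∈ range M, F m := by
    rw [add_comm, sum_range_add, add_eq_left]
    refine sum_eq_zero fun i _ => sum_eq_zero fun π _ => ?_
    rw [pow_add, hq, zero_mul, mul_zero]
  have h₂ : ∑ m ∈ range (j * k), F m = 0 := by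
    refine sum_eq_zero fun m hm => sum_eq_zero fun π _ => ?_
    rw [if_neg, zero_mul]
    exact fun h => absurd (π.mul_le_of_replicate_le h) (not_le.2 (mem_range.1 hm))
  rw [sum_range_add, h₂, zero_add] at h₁
  change ∑ m ∈ range M, F m = _
  rw [← h₁, partGen, mul_sum]
  refine sum_congr rfl fun m _ => ?_
  simp only [F]
  rw [← sum_mul, Nat.Partition.sum_replicate_le m j hk f, pow_add, sum_mul, mul_sum]
  exact sum_congr rfl fun π _ => by ring

lemma partGen_eq_zero_indicator (hM : 0 < M) :
    partGen M q (fun s => if s = 0 then 1 else 0) = 1 := by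
  rw [partGen, sum_eq_single_of_mem 0 (mem_range.2 hM)]
  · simp
  · intro m _ hm
    refine sum_eq_zero fun π _ => ?_
    rw [if_neg, zero_mul]
    intro h
    have := π.parts_sum
    rw [h] at this
    exact hm this.symm

/-- The generating function of partitions all of whose parts are at least `k`. -/
def minPartGen (M : ℕ) (q : R) (k : ℕ) : R :=
  partGen M q fun s => if ∀ i ∈ s, k ≤ i then 1 else 0

lemma minPartGen_succ (hq : q ^ M = 0) {k : ℕ} (hk : 0 < k) :
    minPartGen M q (k + 1) = minPartGen M q k * (1 - q ^ k) := by
  have h := partGen_replicate_le hq 1 hk fun s => if ∀ i ∈ s, k ≤ i then 1 else 0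
  have h' : minPartGen M q k = minPartGen M q (k + 1) + partGen M q (fun s =>
      if Multiset.replicate 1 k ≤ s then (if ∀ i ∈ s, k ≤ i then 1 else 0) else 0) := by
    rw [minPartGen, minPartGen, ← partGen_add]
    congr 1
    funext s
    have : (∀ i ∈ s, k + 1 ≤ i) ↔ (∀ i ∈ s, k ≤ i) ∧ k ∉ s := by
      refine ⟨fun h => ⟨fun i hi => (Nat.le_succ k).trans (h i hi), fun hk => ?_⟩, ?_⟩
      · exact absurd (h k hk) (by omega)
      · rintro ⟨h, hk⟩ i hi
        exact Nat.succ_le_of_lt (lt_of_le_of_ne (h i hi) (by rintro rfl; exact hk hi))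
    simp only [this, Multiset.replicate_one, Multiset.singleton_le]
    by_cases h₁ : k ∈ s <;> by_cases h₂ : ∀ i ∈ s, k ≤ i <;> simp [h₁, h₂]
  have h'' : partGen M q (fun s => if ∀ i ∈ s + Multiset.replicate 1 k, k ≤ i then 1 else 0) =
      minPartGen M q k := by
    rw [minPartGen]
    congr 1
    funext s
    simp [or_imp, forall_and]
  rw [h''] at h
  rw [h, one_mul] at h'
  linear_combination -h'

lemma minPartGen_succ_eq (hq : q ^ M = 0) (k : ℕ) :
    minPartGen M q (k + 1) = qPoch q k * partGen M q fun _ => 1 := by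
  induction k with
  | zero =>
    simp only [qPoch, range_zero, prod_empty, one_mul, minPartGen]
    exact partGen_congr fun m _ π => if_pos fun i hi => π.parts_pos hi
  | succ k ih => rw [minPartGen_succ hq (Nat.add_one_pos k), ih, qPoch_succ]; ring

lemma qPoch_mul_partGen_one {N : ℕ} (hq : q ^ (N + 1) = 0) :
    qPoch q N * partGen (N + 1) q (fun _ => 1) = 1 := by
  rw [← minPartGen_succ_eq hq, minPartGen]
  refine Eq.trans ?_ (partGen_eq_zero_indicator (q := q) N.succ_pos)
  refine partGen_congr fun m hm π => if_congr ⟨fun h => ?_, fun h => by simp [h]⟩ rfl rfl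
  refine Multiset.eq_zero_of_forall_notMem fun i hi => ?_
  have := π.le_of_mem hi
  have := h i hi
  omega

lemma sum_range_replicate_le {m : ℕ} (hm : m < M) (π : m.Partition) (k : ℕ) :
    ∑ j ∈ range M, (if Multiset.replicate (j + 1) k ≤ π.parts then (1 : R) else 0) =
      (π.parts.count k : R) := by
  simp only [← Multiset.le_count_iff_replicate_le]
  rw [← sum_filter, sum_const, nsmul_one]
  congr 1
  have : {j ∈ range M | j + 1 ≤ π.parts.count k} = range (π.parts.count k) := by
    ext j
    have := (Multiset.count_le_card k π.parts).trans π.card_le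
    simp only [mem_filter, mem_range]
    omega
  rw [this, card_range]

lemma sum_mul_pow_eq_geomVar (hq : q ^ M = 0) {j : ℕ} (hj : 0 < j) :
    ∑ k ∈ range M, ((k + 1 : ℕ) : R) * q ^ (j * (k + 1)) = geomVar M q j := by
  have hu := one_sub_pow_mul_geomInv hq hj
  have h : ∀ n, (1 - q ^ j) * ∑ k ∈ range n, ((k + 1 : ℕ) : R) * q ^ (j * (k + 1)) =
      q ^ j * ∑ k ∈ range n, (q ^ j) ^ k - n * q ^ (j * (n + 1)) := by
    intro n
    induction n with
    | zero => simp
    | succ n ih =>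
      rw [sum_range_succ, sum_range_succ, mul_add, ih]
      push_cast
      ring
  have h' := h M
  rw [pow_eq_zero_of_le (n := j * (M + 1)) (by nlinarith) hq, mul_zero, sub_zero] at h'
  change _ = q ^ j * geomInv M q j at h'
  rw [geomVar]
  linear_combination geomInv M q j * h' -
    (∑ k ∈ range M, ((k + 1 : ℕ) : R) * q ^ (j * (k + 1))) * hu

lemma sum_count_mul {m : ℕ} (hm : m < M) (π : m.Partition) :
    ∑ k ∈ range M, ((k + 1 : ℕ) : R) * π.parts.count (k + 1) = m := by
  have h : ∑ k ∈ range M, (k + 1) * π.parts.count (k + 1) = m := by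
    conv_rhs => rw [← π.parts_sum, Finset.sum_multiset_count]
    have h₁ := sum_range_succ' (fun k => k * π.parts.count k) M
    rw [zero_mul, add_zero] at h₁
    rw [← h₁]
    symm
    simp only [smul_eq_mul, mul_comm]
    refine sum_subset (fun i hi => ?_) fun i _ hi => ?_
    · have := π.le_of_mem (Multiset.mem_toFinset.1 hi)
      exact mem_range.2 (by omega)
    · rw [Multiset.count_eq_zero_of_notMem (fun h => hi (Multiset.mem_toFinset.2 h)), mul_zero]
  exact_mod_cast congrArg (Nat.cast : ℕ → R) h

lemma partGen_size (hq : q ^ M = 0) : partGen M q (fun s => (s.sum : R)) =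
    geomVarSum M q M * partGen M q fun _ => 1 := by
  have h : partGen M q (fun s => (s.sum : R)) = partGen M q (fun s => ∑ k ∈ range M,
      ∑ j ∈ range M, ((k + 1 : ℕ) : R) *
        if Multiset.replicate (j + 1) (k + 1) ≤ s then 1 else 0) := by
    refine partGen_congr fun m hm π => ?_
    rw [π.parts_sum, ← sum_count_mul hm π]
    refine sum_congr rfl fun k _ => ?_
    rw [← mul_sum, sum_range_replicate_le hm π]
  rw [h]
  simp only [partGen_sum, partGen_const_mul, partGen_replicate_le hq _ (Nat.add_one_pos _)]
  rw [sum_comm, geomVarSum, sum_mul]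
  refine sum_congr rfl fun j _ => ?_
  rw [← sum_mul_pow_eq_geomVar hq (Nat.add_one_pos j), sum_mul]
  exact sum_congr rfl fun k _ => by ring

lemma count_sInf_eq {m : ℕ} (hm : m < M) (π : m.Partition) :
    (π.parts.count (sInf {i | i ∈ π.parts}) : R) = ∑ k ∈ range M, ∑ j ∈ range M,
      if Multiset.replicate (j + 1) (k + 1) ≤ π.parts then
        (if ∀ i ∈ π.parts, k + 1 ≤ i then 1 else 0) else 0 := by
  have h : ∀ k ∈ range M, (∑ j ∈ range M,
      if Multiset.replicate (j + 1) (k + 1) ≤ π.parts then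
        (if ∀ i ∈ π.parts, k + 1 ≤ i then (1 : R) else 0) else 0) =
      if ∀ i ∈ π.parts, k + 1 ≤ i then (π.parts.count (k + 1) : R) else 0 := by
    intro k _
    rw [← sum_range_replicate_le hm π]
    split_ifs
    · rfl
    · exact sum_eq_zero fun j _ => ite_self 0
  rw [sum_congr rfl h]
  rcases Multiset.empty_or_exists_mem π.parts with h0 | ⟨x, hx⟩
  · simp [h0]
  · have hs : sInf {i | i ∈ π.parts} ∈ π.parts := Nat.sInf_mem (s := {i | i ∈ π.parts}) ⟨x, hx⟩
    have hle : ∀ i ∈ π.parts, sInf {i | i ∈ π.parts} ≤ i := fun i hi => Nat.sInf_le hi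
    generalize sInf {i | i ∈ π.parts} = t at hs hle
    have ht := π.parts_pos hs
    obtain ⟨t, rfl⟩ : ∃ u, t = u + 1 := ⟨t - 1, by omega⟩
    rw [sum_eq_single_of_mem t (mem_range.2 (by have := π.le_of_mem hs; omega)), if_pos hle]
    intro k _ hk
    split_ifs with h'
    · rw [Multiset.count_eq_zero_of_notMem, Nat.cast_zero]
      intro hk'
      have := hle _ hk'
      have := h' _ hs
      omega
    · rfl

lemma partGen_count_sInf (hq : q ^ M = 0) :
    partGen M q (fun s => (s.count (sInf {i | i ∈ s}) : R)) =
      (∑ k ∈ range M, geomVar M q (k + 1) * qPoch q (k + 1)) * partGen M q fun _ => 1 := by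
  rw [partGen_congr (g := fun s => ∑ k ∈ range M, ∑ j ∈ range M,
    if Multiset.replicate (j + 1) (k + 1) ≤ s then
      (if ∀ i ∈ s, k + 1 ≤ i then 1 else 0) else 0) fun m hm π => count_sInf_eq hm π]
  have h : ∀ j k, partGen M q (fun s => if ∀ i ∈ s + Multiset.replicate (j + 1) (k + 1),
      k + 1 ≤ i then 1 else 0) = minPartGen M q (k + 1) := by
    intro j k
    rw [minPartGen]
    congr 1
    funext s
    simp [or_imp, forall_and, Multiset.mem_replicate]
  simp only [partGen_sum]
  rw [sum_mul]
  refine sum_congr rfl fun k _ => ?_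
  have hu := one_sub_pow_mul_geomInv hq (Nat.add_one_pos k)
  have hg : ∑ j ∈ range M, q ^ ((j + 1) * (k + 1)) = q ^ (k + 1) * geomInv M q (k + 1) := by
    rw [geomInv, mul_sum]
    exact sum_congr rfl fun j _ => by ring
  simp only [partGen_replicate_le hq _ (Nat.add_one_pos k) fun s =>
    if ∀ i ∈ s, k + 1 ≤ i then (1 : R) else 0, h, minPartGen_succ_eq hq]
  rw [← sum_mul, hg, geomVar, qPoch_succ]
  linear_combination -q ^ (k + 1) * geomInv M q (k + 1) * qPoch q k *
    (partGen M q fun _ => 1) * hu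

/-- The generating function of partitions with exactly `a` parts, all at most `b`. -/
def boxGen (M : ℕ) (q : R) (a b : ℕ) : R :=
  partGen M q fun s => if Multiset.card s = a ∧ ∀ i ∈ s, i ≤ b then 1 else 0

lemma partGen_boxGen (hq : q ^ M = 0) (a b : ℕ) :
    partGen M q (fun s => if Multiset.replicate 1 (b + 1) ≤ s then
      (if Multiset.card s = a + 1 ∧ ∀ i ∈ s, i ≤ b + 1 then 1 else 0) else 0) =
      q ^ (b + 1) * boxGen M q a (b + 1) := by
  rw [partGen_replicate_le hq 1 (Nat.add_one_pos b) fun s =>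
    if Multiset.card s = a + 1 ∧ ∀ i ∈ s, i ≤ b + 1 then (1 : R) else 0, one_mul, boxGen]
  congr 2
  funext s
  simp [or_imp, forall_and]

lemma boxGen_succ_succ (hq : q ^ M = 0) (a b : ℕ) :
    boxGen M q (a + 1) (b + 1) = boxGen M q (a + 1) b + q ^ (b + 1) * boxGen M q a (b + 1) := by
  rw [← partGen_boxGen hq, boxGen, boxGen, ← partGen_add]
  congr 1
  funext s
  have : (∀ i ∈ s, i ≤ b) ↔ (∀ i ∈ s, i ≤ b + 1) ∧ b + 1 ∉ s := by
    refine ⟨fun h => ⟨fun i hi => (h i hi).trans (Nat.le_succ b), fun hk => ?_⟩, ?_⟩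
    · exact absurd (h _ hk) (by omega)
    · rintro ⟨h, hk⟩ i hi
      exact Nat.le_of_lt_succ (lt_of_le_of_ne (h i hi) (by rintro rfl; exact hk hi))
  simp only [this, Multiset.replicate_one, Multiset.singleton_le]
  by_cases h₁ : b + 1 ∈ s <;> by_cases h₂ : ∀ i ∈ s, i ≤ b + 1 <;> simp [h₁, h₂]

lemma boxGen_zero_left (hM : 0 < M) (b : ℕ) : boxGen M q 0 b = 1 := by
  refine Eq.trans ?_ (partGen_eq_zero_indicator (q := q) hM)
  refine partGen_congr fun m _ π => if_congr ?_ rfl rfl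
  rw [Multiset.card_eq_zero]
  exact ⟨And.left, fun h => ⟨h, by simp [h]⟩⟩

lemma boxGen_succ_zero (a : ℕ) : boxGen M q (a + 1) 0 = 0 := by
  refine (partGen_congr (g := fun _ => 0) fun m _ π => if_neg ?_).trans (by simp [partGen])
  rintro ⟨h, h'⟩
  obtain ⟨i, hi⟩ := Multiset.card_pos_iff_exists_mem.1 (h.symm ▸ Nat.add_one_pos a)
  exact absurd (π.parts_pos hi) (by simpa using h' i hi)

lemma boxGen_eq (hM : 0 < M) (hq : q ^ M = 0) (a b : ℕ) :
    boxGen M q a (b + 1) = q ^ a * gaussBinom q (a + b) b := by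
  induction a generalizing b with
  | zero => simp [boxGen_zero_left hM]
  | succ a iha =>
    induction b with
    | zero =>
      rw [boxGen_succ_succ hq, boxGen_succ_zero, iha]
      simp [pow_succ']
    | succ b ihb =>
      rw [boxGen_succ_succ hq, ihb, iha, ← add_assoc (a + 1),
        gaussBinom_succ_succ, show a + 1 + b = a + (b + 1) by ring]
      ring

lemma Multiset.sup_mem_of_ne_zero {s : Multiset ℕ} (hs : s ≠ 0) : s.sup ∈ s := by
  induction s using Multiset.induction_on with
  | empty => exact absurd rfl hs
  | cons a s ih =>
    rw [Multiset.sup_cons]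
    rcases eq_or_ne s 0 with rfl | h
    · simp
    · rcases le_total a s.sup with h' | h'
      · rw [sup_eq_right.2 h']; exact Multiset.mem_cons_of_mem (ih h)
      · rw [sup_eq_left.2 h']; exact Multiset.mem_cons_self _ _

lemma rank_sq_eq {m : ℕ} (hm : m < M) (π : m.Partition) :
    ((π.parts.sup : R) - Multiset.card π.parts) ^ 2 = ∑ a ∈ range M, ∑ b ∈ range M,
      ((a : R) - b) ^ 2 * if Multiset.replicate 1 (b + 1) ≤ π.parts then
        (if Multiset.card π.parts = a + 1 ∧ ∀ i ∈ π.parts, i ≤ b + 1 then 1 else 0) else 0 := by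
  rcases eq_or_ne π.parts 0 with h0 | h0
  · simp [h0]
  · have hs := Multiset.sup_mem_of_ne_zero h0
    have hle : ∀ i ∈ π.parts, i ≤ π.parts.sup := fun i hi => Multiset.le_sup hi
    have hc := Multiset.card_pos.2 h0
    have hc' := π.card_le
    have ht := π.parts_pos hs
    have ht' := π.le_of_mem hs
    generalize π.parts.sup = t at hs hle ht ht'
    generalize hC : Multiset.card π.parts = c at hc hc'
    obtain ⟨t, rfl⟩ : ∃ u, t = u + 1 := ⟨t - 1, by omega⟩
    obtain ⟨c, rfl⟩ : ∃ u, c = u + 1 := ⟨c - 1, by omega⟩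
    rw [sum_eq_single_of_mem c (mem_range.2 (by omega)),
      sum_eq_single_of_mem t (mem_range.2 (by omega)), if_pos (by simpa using hs),
      if_pos ⟨rfl, hle⟩]
    · push_cast
      ring
    · intro b _ hb
      split_ifs with h₁ h₂
      · have := h₂.2 _ hs
        have := hle _ (Multiset.singleton_le.1 h₁)
        omega
      · simp
      · simp
    · intro a _ ha
      refine sum_eq_zero fun b _ => ?_
      rw [if_neg (c := _ ∧ _) (by omega), ite_self, mul_zero]

lemma sum_sub_sq_mul (g : ℕ → R) :
    ∑ a ∈ range M, ∑ b ∈ range M, ((a : R) - b) ^ 2 * (g a * g b) =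
      2 * ((∑ i ∈ range M, (i : R) ^ 2 * g i) * (∑ i ∈ range M, (i : R) ^ 0 * g i) -
        (∑ i ∈ range M, (i : R) ^ 1 * g i) ^ 2) := by
  have h : ∀ a b : ℕ, ((a : R) - b) ^ 2 * (g a * g b) =
      ((a : R) ^ 2 * g a) * ((b : R) ^ 0 * g b) + ((a : R) ^ 0 * g a) * ((b : R) ^ 2 * g b) -
        2 * (((a : R) ^ 1 * g a) * ((b : R) ^ 1 * g b)) := fun a b => by ring
  simp only [h, sum_sub_distrib, sum_add_distrib, ← mul_sum, ← sum_mul]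
  ring

lemma partGen_rank_sq (hM : 0 < M) (hq : q ^ M = 0) :
    partGen M q (fun s => ((s.sup : R) - Multiset.card s) ^ 2) =
      2 * ∑ m ∈ range M, q ^ ((m + 1) ^ 2) * qPochInv M q (m + 1) ^ 2 *
        geomVarSum M q (m + 1) := by
  rw [partGen_congr (g := fun s => ∑ a ∈ range M, ∑ b ∈ range M,
    ((a : R) - b) ^ 2 * if Multiset.replicate 1 (b + 1) ≤ s then
      (if Multiset.card s = a + 1 ∧ ∀ i ∈ s, i ≤ b + 1 then 1 else 0) else 0)
    fun m hm π => rank_sq_eq hm π]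
  simp only [partGen_sum, partGen_const_mul, partGen_boxGen hq, boxGen_eq hM hq]
  have hV : ∀ a, ∀ b ∈ range M, gaussBinom q (a + b) b =
      ∑ m ∈ range M, q ^ (m ^ 2) * gaussBinom q a m * gaussBinom q b m := by
    intro a b hb
    have h := sum_gaussBinom_mul_gaussBinom q a b 0
    simp only [add_zero, ← sq] at h
    rw [← h]
    refine sum_subset (range_subset_range.2 (mem_range.1 hb)) fun m _ hm => ?_
    rw [gaussBinom_eq_zero q (n := b) (k := m) (by simpa using hm), mul_zero]
  have h : ∀ a ∈ range M, ∀ b ∈ range M,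
      ((a : R) - b) ^ 2 * (q ^ (b + 1) * (q ^ a * gaussBinom q (a + b) b)) =
        ∑ m ∈ range M, q ^ (m ^ 2 + 1) * (((a : R) - b) ^ 2 *
          ((q ^ a * gaussBinom q a m) * (q ^ b * gaussBinom q b m))) := by
    intro a _ b hb
    rw [hV a b hb]
    simp only [mul_sum]
    exact sum_congr rfl fun m _ => by ring
  rw [sum_congr rfl fun a ha => sum_congr rfl (h a ha)]
  have hswap : ∀ F : ℕ → ℕ → ℕ → R, ∑ a ∈ range M, ∑ b ∈ range M, ∑ m ∈ range M, F a b m =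
      ∑ m ∈ range M, ∑ a ∈ range M, ∑ b ∈ range M, F a b m := by
    intro F
    rw [sum_comm (s := range M) (t := range M) (f := fun m a => ∑ b ∈ range M, F a b m)]
    exact sum_congr rfl fun a _ => sum_comm
  rw [hswap, mul_sum]
  refine sum_congr rfl fun m _ => ?_
  have hv := gaussMoment_variance hq m
  rw [gaussMoment_zero hq] at hv
  simp only [← mul_sum]
  rw [sum_sub_sq_mul]
  change q ^ (m ^ 2 + 1) * (2 * (gaussMoment M q 2 m * gaussMoment M q 0 m -
    gaussMoment M q 1 m ^ 2)) = _
  rw [gaussMoment_zero hq, hv]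
  ring

/-- The truncated generating function form of Andrews' identity. -/
lemma two_mul_partGen_count_sInf_add {N : ℕ} (hq : q ^ (N + 1) = 0) :
    2 * partGen (N + 1) q (fun s => (s.count (sInf {i | i ∈ s}) : R)) +
      partGen (N + 1) q (fun s => ((s.sup : R) - Multiset.card s) ^ 2) =
      2 * partGen (N + 1) q (fun s => (s.sum : R)) := by
  have hP := qPoch_mul_partGen_one hq
  have hlast : geomVar (N + 1) q (N + 1) = 0 := by rw [geomVar, hq, zero_mul]
  have hD : ∑ m ∈ range N, q ^ ((m + 1) ^ 2) * qPochInv (N + 1) q (m + 1) ^ 2 *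
        geomVarSum (N + 1) q (m + 1) =
      (∑ n ∈ range (N + 1), durfeeTerm (N + 1) q N n * geomVarSum (N + 1) q n) *
        partGen (N + 1) q fun _ => 1 := by
    rw [sum_range_succ']
    simp only [geomVarSum, range_zero, sum_empty, mul_zero, add_zero]
    rw [sum_mul]
    refine sum_congr rfl fun n hn => ?_
    rw [durfeeTerm_eq_of_pow_succ hq (by simpa using hn)]
    linear_combination -q ^ ((n + 1) ^ 2) * qPochInv (N + 1) q (n + 1) ^ 2 *
      (∑ k ∈ range (n + 1), geomVar (N + 1) q (k + 1)) * hP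
  rw [partGen_count_sInf hq, partGen_rank_sq N.succ_pos hq, partGen_size hq, sum_range_succ,
    sum_range_succ, geomVarSum_succ, hlast,
    pow_eq_zero_of_le (n := (N + 1) ^ 2) (Nat.le_self_pow two_ne_zero _) hq, hD]
  linear_combination -2 * (partGen (N + 1) q fun _ => 1) * geomVarSum_eq hq N

end PartitionGenerating

lemma coeff_eq_zero_of_nilpotent (n : ℕ) (c : ℕ → ℤ)
    (h : ∀ q : AdjoinRoot (Polynomial.X ^ (n + 1) : Polynomial ℤ), q ^ (n + 1) = 0 →
      ∑ m ∈ range (n + 1), (c m : AdjoinRoot (Polynomial.X ^ (n + 1) : Polynomial ℤ)) * q ^ m = 0) :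
    c n = 0 := by
  have hroot : AdjoinRoot.root (Polynomial.X ^ (n + 1) : Polynomial ℤ) ^ (n + 1) = 0 := by
    rw [← AdjoinRoot.mk_X, ← map_pow, AdjoinRoot.mk_self]
  have h₁ := h _ hroot
  have h₂ : AdjoinRoot.mk (Polynomial.X ^ (n + 1) : Polynomial ℤ)
      (∑ m ∈ range (n + 1), Polynomial.C (c m) * Polynomial.X ^ m) = 0 := by
    rw [← h₁, map_sum]
    refine sum_congr rfl fun m _ => ?_
    rw [map_mul, map_pow, AdjoinRoot.mk_X, ← map_intCast (AdjoinRoot.mk _), ← Polynomial.C_eq_intCast,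
      Int.cast_id]
  have h₃ := Polynomial.X_pow_dvd_iff.1 (AdjoinRoot.mk_eq_zero.1 h₂) n (Nat.lt_succ_self n)
  simpa [Polynomial.finsetSum_coeff, Polynomial.coeff_C_mul, Polynomial.coeff_X_pow] using h₃

/-- Andrews' spt identity (Corollary 2.8): 2·spt(n) + N₂(n) = 2n·p(n), where
spt(n) = ∑_{π ∈ P(n)} (multiplicity of the smallest part of π),
N₂(n) = ∑_{π ∈ P(n)} (l(π) − #(π))², and p(n) is the number of partitions of n. -/
theorem stmt10 (n : ℕ) (hn : 0 < n) :
    2 * (∑ π : n.Partition, (Multiset.count (sPart π) π.parts : ℤ)) +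
      ∑ π : n.Partition, ((lPart π : ℤ) - Multiset.card π.parts) ^ 2 =
      2 * n * Fintype.card n.Partition := by
  rw [← sub_eq_zero]
  refine coeff_eq_zero_of_nilpotent n (fun m =>
    2 * (∑ π : m.Partition, (Multiset.count (sPart π) π.parts : ℤ)) +
      ∑ π : m.Partition, ((lPart π : ℤ) - Multiset.card π.parts) ^ 2 -
      2 * m * Fintype.card m.Partition) fun q hq => ?_
  rw [← sub_eq_zero.2 (two_mul_partGen_count_sInf_add hq)]
  simp only [partGen, mul_sum, ← sum_add_distrib, ← sum_sub_distrib]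
  refine sum_congr rfl fun m _ => ?_
  have h : (Fintype.card m.Partition : ℤ) = ∑ π : m.Partition, 1 := by simp
  rw [h]
  simp only [mul_sum, ← sum_sub_distrib, Int.cast_sum, sum_mul]
  refine sum_congr rfl fun π _ => ?_
  rw [π.parts_sum, sPart, lPart]
  push_cast
  ring
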